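/- Let A ≥ 100 and 0 < δ ≤ σ ≤ 1, and let 𝓡 be a family of pairwise 100-incomparable (δ,σ)-rectangles. Suppose that there exists a fixed (δ,σ)-rectangle 𝐑 such that the union of the rectangles in 𝓡 is contained in A·𝐑. Then |𝓡| ≤ K A^{10}, where K is an absolute constant. -/

import Mathlib

open Metric Set

noncomputable section

/-- The plane `ℝ²`. -/
abbrev Plane := EuclideanSpace ℝ (Fin 2)

/-- The parameter space `ℝ² × ℝ` of circles: a pair `(x, r)` of a centre and a radius. -/
abbrev Param := (EuclideanSpace ℝ (Fin 2)) × ℝ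

/-- The point of `ℝ²` with coordinates `a`, `b`. -/
def mk2 (a b : ℝ) : Plane := (WithLp.equiv 2 (Fin 2 → ℝ)).symm ![a, b]

/-- The Euclidean distance on `ℝ² × ℝ`, viewed as `ℝ³`. -/
def pdist (p q : Param) : ℝ := Real.sqrt (dist p.1 q.1 ^ 2 + (p.2 - q.2) ^ 2)

/-- The tangency parameter `Δ(p,q) = ||x - x'| - |r - r'||`. -/
def tang (p q : Param) : ℝ := abs (dist p.1 q.1 - |p.2 - q.2|)

/-- The domain `𝐃 = {(x,r) : |x| ≤ 1/4, r ∈ [1/2, 1]}`. -/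
def domD : Set Param := {p | ‖p.1‖ ≤ 1 / 4 ∧ p.2 ∈ Set.Icc (1 / 2 : ℝ) 1}

/-- The circle `S(p)` with centre `p.1` and radius `p.2`. -/
def circ (p : Param) : Set Plane := Metric.sphere p.1 p.2

/-- The closed `δ`-annulus `S^δ(p)` around the circle `S(p)`. -/
def annulus (δ : ℝ) (p : Param) : Set Plane := {w | Metric.infDist w (circ p) ≤ δ}

/-- The `(δ,σ)`-rectangle `R^δ_σ(p,v) = S^δ(p) ∩ B(v,σ)`. -/
def rect (δ σ : ℝ) (p : Param) (v : Plane) : Set Plane :=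
  annulus δ p ∩ Metric.closedBall v σ

/-- Admissible data `(p, v)` for a rectangle: `p ∈ 𝐃` and `v ∈ S(p)`. -/
def IsRectData (r : Param × Plane) : Prop := r.1 ∈ domD ∧ r.2 ∈ circ r.1

/-- `C`-comparability of two rectangles (given by their data): there is a third
`(δ,σ)`-rectangle `R` with `R₁ ∪ R₂ ⊆ C·R`. -/
def Comp (δ σ C : ℝ) (r₁ r₂ : Param × Plane) : Prop :=
  ∃ r : Param × Plane, IsRectData r ∧
    rect δ σ r₁.1 r₁.2 ∪ rect δ σ r₂.1 r₂.2 ⊆ rect (C * δ) (C * σ) r.1 r.2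

/-- The index of the dyadic `δ`-cube of `ℝ²` containing a point. -/
def idx2 (δ : ℝ) (v : Plane) : ℤ × ℤ := (⌊v 0 / δ⌋, ⌊v 1 / δ⌋)

/-- The index of the dyadic `δ`-cube of `ℝ³ = ℝ² × ℝ` containing a point. -/
def idx3 (δ : ℝ) (p : Param) : (ℤ × ℤ) × ℤ := (idx2 δ p.1, ⌊p.2 / δ⌋)

/-- `|E|_δ`: the number of dyadic `δ`-cubes intersecting `E ⊆ ℝ²`. -/
def count2 (δ : ℝ) (E : Set Plane) : ℕ := Nat.card (idx2 δ '' E)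

/-- `|P|_δ`: the number of dyadic `δ`-cubes intersecting `P ⊆ ℝ³`. -/
def count3 (δ : ℝ) (P : Set Param) : ℕ := Nat.card (idx3 δ '' P)

/-- `|Ω|_δ`: the number of dyadic `δ`-cubes of `ℝ⁵ = ℝ³ × ℝ²` intersecting `Ω`. -/
def count5 (δ : ℝ) (Ω : Set (Param × Plane)) : ℕ :=
  Nat.card ((fun ω => (idx3 δ ω.1, idx2 δ ω.2)) '' Ω)

/-- A `(δ,s,C)`-set in the plane. -/
def IsDSet2 (δ s C : ℝ) (E : Set Plane) : Prop :=
  Bornology.IsBounded E ∧ ∀ (x : Plane) (r : ℝ), δ ≤ r →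
    (count2 δ (E ∩ Metric.closedBall x r) : ℝ) ≤ C * r ^ s * (count2 δ E : ℝ)

/-- A `(δ,s,C)`-set in `ℝ³ = ℝ² × ℝ`. -/
def IsDSet3 (δ s C : ℝ) (P : Set Param) : Prop :=
  Bornology.IsBounded P ∧ ∀ (x : Param) (r : ℝ), δ ≤ r →
    (count3 δ (P ∩ {q | pdist q x ≤ r}) : ℝ) ≤ C * r ^ s * (count3 δ P : ℝ)

/-- `x ∈ 2^{-ℕ}`. -/
def IsDyadic (x : ℝ) : Prop := ∃ n : ℕ, x = (2 : ℝ) ^ (-(n : ℤ))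

/-- The smallest dyadic rational `2^{-n} ≥ σ` (for `σ ∈ (0,1]`). -/
def dyadicCeil (σ : ℝ) : ℝ := (2 : ℝ) ^ (-⌊Real.logb 2 σ⁻¹⌋)

/-- Indices of dyadic cubes in `ℝ³ = ℝ² × ℝ`. -/
abbrev CubeIdx := (ℤ × ℤ) × ℤ

/-- The dyadic cube of side length `δ` with index `k`. -/
def cubeSet (δ : ℝ) (k : CubeIdx) : Set Param :=
  {p | (k.1.1 : ℝ) * δ ≤ p.1 0 ∧ p.1 0 < ((k.1.1 : ℝ) + 1) * δ ∧
       (k.1.2 : ℝ) * δ ≤ p.1 1 ∧ p.1 1 < ((k.1.2 : ℝ) + 1) * δ ∧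
       (k.2 : ℝ) * δ ≤ p.2 ∧ p.2 < ((k.2 : ℝ) + 1) * δ}

/-- The centre of the dyadic cube of side length `δ` with index `k`. -/
def cubeCtr (δ : ℝ) (k : CubeIdx) : Param :=
  (mk2 (((k.1.1 : ℝ) + 1 / 2) * δ) (((k.1.2 : ℝ) + 1 / 2) * δ), ((k.2 : ℝ) + 1 / 2) * δ)

/-- The unit vector with angle `θ`. -/
def dir (θ : ℝ) : Plane := mk2 (Real.cos θ) (Real.sin θ)

/-- The `j`-th (half-open) arc of the partition `𝒮_σ(p)` of the circle `S(p)`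
into arcs of length `2πrσ`. -/
def arcSet (p : Param) (σ : ℝ) (j : ℤ) : Set Plane :=
  {w | ∃ θ : ℝ, (j : ℝ) * (2 * Real.pi * σ) ≤ θ ∧ θ < ((j : ℝ) + 1) * (2 * Real.pi * σ) ∧
    w = p.1 + p.2 • dir θ}

/-- The centre of the `j`-th arc of `𝒮_σ(p)`. -/
def arcCenterAt (p : Param) (σ : ℝ) (j : ℤ) : Plane :=
  p.1 + p.2 • dir (((j : ℝ) + 1 / 2) * (2 * Real.pi * σ))

/-- Valid indices for the arcs of `𝒮_σ(p)`. -/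
def validArc (σ : ℝ) (j : ℤ) : Prop := 0 ≤ j ∧ (j : ℝ) < σ⁻¹

/-- The (one-sided) cone `V(p, I)` centred at the centre of `p` and spanned by `I`. -/
def cone (p : Param) (I : Set Plane) : Set Plane :=
  {x | ∃ e ∈ I, ∃ t : ℝ, 0 ≤ t ∧ x = p.1 + t • (e - p.1)}

/-- A pair: (index of a dyadic cube in `ℝ³`, index of an arc). -/
abbrev DPair := CubeIdx × ℤ

/-- The relation `(p,v) ≺ (𝐩,𝐯)` between pairs at scales `(δ,σ)` and `(Δ,Σ)`. -/
def prec (δ σ Δ Sg : ℝ) (ω W : DPair) : Prop :=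
  cubeSet δ ω.1 ⊆ cubeSet Δ W.1 ∧
  arcCenterAt (cubeCtr δ ω.1) σ ω.2 ∈ cone (cubeCtr Δ W.1) (arcSet (cubeCtr Δ W.1) Sg W.2)

/-- The `(Δ,Σ)`-skeleton `Ω^Δ_Σ` of a set of pairs at scales `(δ,σ)`. -/
def skeleton (δ σ Δ Sg : ℝ) (Ω : Set DPair) : Set DPair :=
  {W | cubeSet Δ W.1 ⊆ domD ∧ validArc Sg W.2 ∧ ∃ ω ∈ Ω, prec δ σ Δ Sg ω W}

/-- The cube family `P` of a configuration. -/
def configP (Ω : Set DPair) : Set CubeIdx := Prod.fst '' Ω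

/-- The arc family `E_σ(p)` of a configuration. -/
def configE (Ω : Set DPair) (k : CubeIdx) : Set ℤ := {j | (k, j) ∈ Ω}

/-- A (dyadic) `(δ,σ,s,C,M)`-configuration. -/
def IsConfigD (δ σ s C : ℝ) (M : ℕ) (Ω : Set DPair) : Prop :=
  (configP Ω).Nonempty ∧
  (∀ k ∈ configP Ω, cubeSet δ k ⊆ domD) ∧
  IsDSet3 δ s C (⋃ k ∈ configP Ω, cubeSet δ k) ∧
  ∀ k ∈ configP Ω,
    (∀ j ∈ configE Ω k, validArc σ j) ∧
    IsDSet2 σ s C (⋃ j ∈ configE Ω k, arcSet (cubeCtr δ k) σ j) ∧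
    Nat.card (configE Ω k) = M

/-- The partial multiplicity function `m^{ρ_λ,ρ_t,C}_{Δ,λ,t}(ω ∣ G)`, counting pairs in the
`(Δ, σa)`-skeleton of `G`; the geometric data of `ω` is given by the circle parameter `pω`
(the centre of the cube of `ω`) and the arc centre `vω`. -/
def pMult (baseδ baseσ Δ σa lam t ρl ρt C : ℝ) (G : Set DPair) (pω : Param) (vω : Plane) : ℕ :=
  Nat.card {ω' : DPair | ω' ∈ skeleton baseδ baseσ Δ σa G ∧
    (lam ≤ ρl * Δ ∨ lam / ρl ≤ tang pω (cubeCtr Δ ω'.1)) ∧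
    tang pω (cubeCtr Δ ω'.1) ≤ ρl * lam ∧
    t / ρt ≤ pdist pω (cubeCtr Δ ω'.1) ∧
    pdist pω (cubeCtr Δ ω'.1) ≤ ρt * t ∧
    (rect (C * Δ) (C * σa) pω vω ∩
      rect (C * Δ) (C * σa) (cubeCtr Δ ω'.1) (arcCenterAt (cubeCtr Δ ω'.1) σa ω'.2)).Nonempty}

/-- A `δ`-separated set in `ℝ³ = ℝ² × ℝ`. -/
def sep3 (δ : ℝ) (A : Set Param) : Prop := ∀ p ∈ A, ∀ q ∈ A, p ≠ q → δ ≤ pdist p q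

/-- A `(δ,ε)`-almost `t`-bipartite pair. -/
def AlmostBipartite (δ ε t : ℝ) (W B : Set Param) : Prop :=
  sep3 δ W ∧ sep3 δ B ∧ (∀ p ∈ W, ∀ q ∈ B, δ ^ ε * t ≤ pdist p q) ∧
    ∀ p ∈ W ∪ B, ∀ q ∈ W ∪ B, pdist p q ≤ δ ^ (-ε) * t

/-- A `t`-bipartite pair (relative to the scale `δ`). -/
def Bipartite (δ t : ℝ) (W B : Set Param) : Prop :=
  sep3 δ W ∧ sep3 δ B ∧
  (∀ p ∈ W, ∀ q ∈ W, pdist p q ≤ t) ∧ (∀ p ∈ B, ∀ q ∈ B, pdist p q ≤ t) ∧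
  (∀ p ∈ B, ∀ q ∈ W, t ≤ pdist p q) ∧
  ∀ p ∈ W ∪ B, ∀ q ∈ W ∪ B, pdist p q ≤ 100 * t


theorem pack_aux {ι : Type*} [DecidableEq ι] (S : Finset ι) (F : ι → ℝ) (s L M : ℝ) (hs : 0 < s)
    (hL : 1 ≤ L) (hM : 0 ≤ M) (hF : ∀ i ∈ S, |F i| ≤ L * s)
    (h : ∀ T : Finset ι, T ⊆ S → (∀ i ∈ T, ∀ j ∈ T, |F i - F j| ≤ s) → (T.card : ℝ) ≤ M) :
    (S.card : ℝ) ≤ 4 * L * M := by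
  classical
  have hmaps : ∀ i ∈ S, ⌊F i / s⌋ ∈ Finset.Icc ⌊-L⌋ ⌊L⌋ := by
    intro i hi
    have h1 := abs_le.1 (hF i hi)
    rw [Finset.mem_Icc]
    constructor
    · apply Int.floor_le_floor
      rw [le_div_iff₀ hs]; linarith [h1.1]
    · apply Int.floor_le_floor
      rw [div_le_iff₀ hs]; linarith [h1.2]
  have hcard : S.card = ∑ k ∈ Finset.Icc ⌊-L⌋ ⌊L⌋, (S.filter (fun i => ⌊F i / s⌋ = k)).card :=
    Finset.card_eq_sum_card_fiberwise hmaps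
  have hfib : ∀ k ∈ Finset.Icc ⌊-L⌋ ⌊L⌋,
      ((S.filter (fun i => ⌊F i / s⌋ = k)).card : ℝ) ≤ M := by
    intro k _
    apply h _ (Finset.filter_subset _ _)
    intro i hi j hj
    have hi' := (Finset.mem_filter.1 hi).2
    have hj' := (Finset.mem_filter.1 hj).2
    have := Int.abs_sub_lt_one_of_floor_eq_floor (hi'.trans hj'.symm)
    rw [← sub_div, abs_div, abs_of_pos hs, div_lt_one hs] at this
    exact this.le
  have : (S.card : ℝ) ≤ ∑ k ∈ Finset.Icc ⌊-L⌋ ⌊L⌋, M := by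
    rw [hcard]; push_cast
    exact Finset.sum_le_sum hfib
  refine this.trans ?_
  rw [Finset.sum_const, nsmul_eq_mul, Int.card_Icc]
  apply mul_le_mul_of_nonneg_right _ hM
  have h1 : ⌊-L⌋ ≤ ⌊L⌋ := Int.floor_le_floor (by linarith)
  have h2 : (((⌊L⌋ + 1 - ⌊-L⌋).toNat : ℤ) : ℝ) = ((⌊L⌋ + 1 - ⌊-L⌋ : ℤ) : ℝ) := by
    rw [Int.toNat_of_nonneg (by linarith)]
  rw [Int.cast_natCast] at h2
  rw [h2]; push_cast
  have := Int.floor_le L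
  have := Int.lt_floor_add_one (-L)
  linarith

theorem annulus_fwd {p : Param} (hp : 0 ≤ p.2) {w : Plane} {δ : ℝ} (h : w ∈ annulus δ p) :
    |dist w p.1 - p.2| ≤ δ := by
  have hne : (circ p).Nonempty := NormedSpace.sphere_nonempty.2 hp
  obtain ⟨z, hz, hd⟩ := (isCompact_sphere p.1 p.2).exists_infDist_eq_dist hne w
  have h' : dist w z ≤ δ := by rw [← hd]; exact h
  have hz' : dist z p.1 = p.2 := hz
  have h1 := dist_triangle w z p.1
  have h2 := dist_triangle z w p.1
  rw [dist_comm z w] at h2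
  rw [abs_le]; constructor <;> linarith

theorem annulus_bwd {p : Param} (hp : 0 ≤ p.2) {w : Plane} {δ : ℝ}
    (h : |dist w p.1 - p.2| ≤ δ) : w ∈ annulus δ p := by
  have hne : (circ p).Nonempty := NormedSpace.sphere_nonempty.2 hp
  show Metric.infDist w (circ p) ≤ δ
  by_cases hw : w = p.1
  · obtain ⟨z, hz⟩ := hne
    have hz' : dist z p.1 = p.2 := hz
    refine (Metric.infDist_le_dist_of_mem hz).trans ?_
    rw [hw, dist_self, zero_sub, abs_neg, abs_of_nonneg hp] at h
    rw [hw, dist_comm, hz']; exact h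
  · have hpos : 0 < ‖w - p.1‖ := norm_pos_iff.2 (sub_ne_zero.2 hw)
    have hz : p.1 + (p.2 / ‖w - p.1‖) • (w - p.1) ∈ circ p := by
      show dist _ _ = _
      rw [dist_eq_norm, add_sub_cancel_left, norm_smul, Real.norm_of_nonneg (by positivity)]
      field_simp
    refine (Metric.infDist_le_dist_of_mem hz).trans ?_
    rw [dist_eq_norm] at h ⊢
    have : w - (p.1 + (p.2 / ‖w - p.1‖) • (w - p.1)) = (1 - p.2 / ‖w - p.1‖) • (w - p.1) := by
      module
    rw [this, norm_smul, Real.norm_eq_abs]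
    have e : |1 - p.2 / ‖w - p.1‖| * ‖w - p.1‖ = |‖w - p.1‖ - p.2| := by
      conv_lhs => rw [← abs_of_pos hpos, ← abs_mul, abs_of_pos hpos]
      congr 1; field_simp
    rw [e]; exact h

theorem dist_sq_plane (a b : Plane) : dist a b ^ 2 = (a 0 - b 0) ^ 2 + (a 1 - b 1) ^ 2 := by
  rw [EuclideanSpace.dist_eq, Real.sq_sqrt (by positivity), Fin.sum_univ_two, Real.dist_eq,
    Real.dist_eq, sq_abs, sq_abs]

/-- data of a member, in coordinates -/
structure Mem (A δ σ y1 y2 ρ x1 x2 r v1 v2 n1 n2 : ℝ) : Prop where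
  hv1 : v1 = x1 + r * n1
  hv2 : v2 = x2 + r * n2
  hn : n1 ^ 2 + n2 ^ 2 = 1
  hr : 1 / 2 ≤ r
  hr1 : r ≤ 1
  hρ : 1 / 2 ≤ ρ
  hd : (x1 - y1) ^ 2 + (x2 - y2) ^ 2 ≤ 1 / 4
  hw : ∀ w1 w2, (w1 - x1) ^ 2 + (w2 - x2) ^ 2 = r ^ 2 → (w1 - v1) ^ 2 + (w2 - v2) ^ 2 ≤ σ ^ 2 →
    |(w1 - y1) ^ 2 + (w2 - y2) ^ 2 - ρ ^ 2| ≤ 4 * (A * δ)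

/-- two auxiliary points on the arc -/
theorem mem_pts {A δ σ y1 y2 ρ x1 x2 r v1 v2 n1 n2 : ℝ} (hσ : 0 < σ) (hσ1 : σ ≤ 1)
    (m : Mem A δ σ y1 y2 ρ x1 x2 r v1 v2 n1 n2) :
    ∃ c : ℝ, c ^ 2 + (σ / 2) ^ 2 = 1 ∧ 0 ≤ c ∧ c ≤ 1 ∧ σ ^ 2 / 8 ≤ 1 - c ∧
    ∀ s, (s = σ / 2 ∨ s = - (σ / 2)) →
     ((x1 + r * (c * n1 - s * n2)) - x1) ^ 2 + ((x2 + r * (c * n2 + s * n1)) - x2) ^ 2 = r ^ 2 ∧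
     ((x1 + r * (c * n1 - s * n2)) - v1) ^ 2 + ((x2 + r * (c * n2 + s * n1)) - v2) ^ 2 ≤ σ ^ 2 := by
  obtain ⟨hv1, hv2, hn, hr, hr1, hρ, hd, hw⟩ := m
  have h0 : 0 ≤ 1 - (σ / 2) ^ 2 := by nlinarith
  refine ⟨Real.sqrt (1 - (σ / 2) ^ 2), ?_, Real.sqrt_nonneg _, ?_, ?_, ?_⟩
  · rw [Real.sq_sqrt h0]; ring
  · exact Real.sqrt_le_iff.2 ⟨zero_le_one, by nlinarith⟩
  · have : Real.sqrt (1 - (σ / 2) ^ 2) ≤ 1 - σ ^ 2 / 8 := by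
      apply Real.sqrt_le_iff.2
      constructor
      · nlinarith
      · nlinarith [sq_nonneg (σ ^ 2)]
    linarith
  · intro s hs
    have hc := Real.sq_sqrt h0
    have hcn := Real.sqrt_nonneg (1 - (σ / 2) ^ 2)
    set c := Real.sqrt (1 - (σ / 2) ^ 2) with hcdef
    have hs2 : s ^ 2 = (σ / 2) ^ 2 := by rcases hs with h | h <;> rw [h]; ring
    have hcs : c ^ 2 + s ^ 2 = 1 := by rw [hs2, hc]; ring
    constructor
    · have : ((x1 + r * (c * n1 - s * n2)) - x1) ^ 2 + ((x2 + r * (c * n2 + s * n1)) - x2) ^ 2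
        = r ^ 2 * ((c ^ 2 + s ^ 2) * (n1 ^ 2 + n2 ^ 2)) := by ring
      rw [this, hcs, hn]; ring
    · have : ((x1 + r * (c * n1 - s * n2)) - v1) ^ 2 + ((x2 + r * (c * n2 + s * n1)) - v2) ^ 2
        = r ^ 2 * ((c ^ 2 + s ^ 2 + 1 - 2 * c) * (n1 ^ 2 + n2 ^ 2)) := by rw [hv1, hv2]; ring
      rw [this, hcs, hn]
      have hcle : c ≤ 1 := Real.sqrt_le_iff.2 ⟨zero_le_one, by linarith [sq_nonneg (σ / 2)]⟩
      have hc1 : 1 - c ≤ (σ / 2) ^ 2 := by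
        have h8 := mul_le_mul_of_nonneg_left hcle hcn
        linarith
      have hr2 : r ^ 2 ≤ 1 := pow_le_one₀ (by linarith) hr1
      have h9 : 0 ≤ 1 - c := by linarith
      have h10 := mul_le_mul hr2 hc1 h9 zero_le_one
      linarith [sq_nonneg σ]

theorem mem_self {A δ σ y1 y2 ρ x1 x2 r v1 v2 n1 n2 : ℝ}
    (m : Mem A δ σ y1 y2 ρ x1 x2 r v1 v2 n1 n2) :
    |(v1 - y1) ^ 2 + (v2 - y2) ^ 2 - ρ ^ 2| ≤ 4 * (A * δ) := by
  apply m.hw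
  · rw [m.hv1, m.hv2]
    linear_combination r ^ 2 * m.hn
  · simp; positivity

theorem mem_tan {A δ σ y1 y2 ρ x1 x2 r v1 v2 n1 n2 : ℝ} (hσ : 0 < σ) (hσ1 : σ ≤ 1)
    (m : Mem A δ σ y1 y2 ρ x1 x2 r v1 v2 n1 n2) :
    |(x2 - y2) * n1 - (x1 - y1) * n2| * σ ≤ 8 * (A * δ) := by
  obtain ⟨c, hc, hc0, hc1, hc2, hp⟩ := mem_pts hσ hσ1 m
  have e1 := abs_le.1 (m.hw _ _ (hp _ (Or.inl rfl)).1 (hp _ (Or.inl rfl)).2)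
  have e2 := abs_le.1 (m.hw _ _ (hp _ (Or.inr rfl)).1 (hp _ (Or.inr rfl)).2)
  have hr := m.hr
  set X := (x2 - y2) * n1 - (x1 - y1) * n2 with hX
  have key : |2 * r * σ * X| ≤ 8 * (A * δ) := by
    rw [abs_le]; constructor
    · rw [hX]; nlinarith [e1.1, e2.2]
    · rw [hX]; nlinarith [e1.2, e2.1]
  have : |2 * r * σ * X| = 2 * r * (|X| * σ) := by
    rw [abs_mul, abs_of_pos (by positivity)]; ring
  rw [this] at key
  have : 0 ≤ |X| * σ := by positivity
  nlinarith

theorem mem_nor {A δ σ y1 y2 ρ x1 x2 r v1 v2 n1 n2 : ℝ} (hA : 100 ≤ A) (hδ : 0 < δ)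
    (hσ : 0 < σ) (hσ1 : σ ≤ 1)
    (m : Mem A δ σ y1 y2 ρ x1 x2 r v1 v2 n1 n2) :
    |(x1 - y1) * n1 + (x2 - y2) * n2| * (σ ^ 2 + δ) ≤ 65 * (A * δ) := by
  obtain ⟨c, hc, hc0, hc1, hc2, hp⟩ := mem_pts hσ hσ1 m
  have e1 := abs_le.1 (m.hw _ _ (hp _ (Or.inl rfl)).1 (hp _ (Or.inl rfl)).2)
  have e2 := abs_le.1 (m.hw _ _ (hp _ (Or.inr rfl)).1 (hp _ (Or.inr rfl)).2)
  have e3 := abs_le.1 (mem_self m)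
  have hr := m.hr
  have hn := m.hn
  have hd := m.hd
  set X := (x1 - y1) * n1 + (x2 - y2) * n2 with hX
  have id : ((x1 + r * (c * n1 - σ / 2 * n2)) - y1) ^ 2 + ((x2 + r * (c * n2 + σ / 2 * n1)) - y2) ^ 2
      - ρ ^ 2 +
      (((x1 + r * (c * n1 - -(σ / 2) * n2)) - y1) ^ 2 +
        ((x2 + r * (c * n2 + -(σ / 2) * n1)) - y2) ^ 2 - ρ ^ 2)
      - 2 * ((v1 - y1) ^ 2 + (v2 - y2) ^ 2 - ρ ^ 2) = - (4 * r * (1 - c) * X) := by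
    rw [m.hv1, m.hv2, hX]
    linear_combination (2 * r ^ 2 * (c ^ 2 + (σ / 2) ^ 2) - 2 * r ^ 2) * hn + 2 * r ^ 2 * hc
  have key : |4 * r * (1 - c) * X| ≤ 16 * (A * δ) := by
    rw [abs_le]; constructor
    · linarith [e1.2, e2.2, e3.1]
    · linarith [e1.1, e2.1, e3.2]
  have h1c : 0 ≤ 1 - c := by linarith
  have : |4 * r * (1 - c) * X| = 4 * r * ((1 - c) * |X|) := by
    rw [abs_mul, abs_of_nonneg (by positivity)]; ring
  rw [this] at key
  have hXn := abs_nonneg X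
  have h1 : σ ^ 2 / 8 * |X| ≤ (1 - c) * |X| := mul_le_mul_of_nonneg_right hc2 hXn
  have h2 : (1 - c) * |X| ≤ 8 * (A * δ) := by
    have h5 : 0 ≤ (1 - c) * |X| := by positivity
    have h6 := mul_le_mul_of_nonneg_right hr h5
    linarith
  have h3 : |X| ≤ 1 := by
    rw [abs_le_one_iff_mul_self_le_one]
    have : X * X + ((x2 - y2) * n1 - (x1 - y1) * n2) ^ 2 ≤ 1 / 4 := by
      have : X * X + ((x2 - y2) * n1 - (x1 - y1) * n2) ^ 2
        = ((x1 - y1) ^ 2 + (x2 - y2) ^ 2) * (n1 ^ 2 + n2 ^ 2) := by rw [hX]; ring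
      rw [this, hn]; linarith
    linarith [sq_nonneg ((x2 - y2) * n1 - (x1 - y1) * n2)]
  have h4 : |X| * δ ≤ A * δ := mul_le_mul_of_nonneg_right (by linarith) hδ.le
  linarith

theorem mem_near {A δ σ y1 y2 ρ x1 x2 r v1 v2 n1 n2 : ℝ} (hA : 100 ≤ A) (hδ : 0 < δ)
    (hσ : 0 < σ) (hσ1 : σ ≤ 1)
    (m : Mem A δ σ y1 y2 ρ x1 x2 r v1 v2 n1 n2) (w1 w2 : ℝ)
    (hw : |(w1 - y1) ^ 2 + (w2 - y2) ^ 2 - ρ ^ 2| ≤ 4 * (A * δ))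
    (hwv : (w1 - v1) ^ 2 + (w2 - v2) ^ 2 ≤ 4 * σ ^ 2) :
    |(w1 - v1) * n1 + (w2 - v2) * n2| ≤ 104 * (A * (σ ^ 2 + δ)) ∧
    |(w2 - v2) * n1 - (w1 - v1) * n2| ≤ 2 * σ := by
  have hn := m.hn
  have hρ := m.hρ
  set a := (w1 - v1) * n1 + (w2 - v2) * n2 with ha
  set b := (w2 - v2) * n1 - (w1 - v1) * n2 with hb
  have hab : a ^ 2 + b ^ 2 ≤ (2 * σ) ^ 2 := by
    have : a ^ 2 + b ^ 2 = ((w1 - v1) ^ 2 + (w2 - v2) ^ 2) * (n1 ^ 2 + n2 ^ 2) := by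
      rw [ha, hb]; ring
    rw [this, hn]; linarith
  have ha2 : |a| ≤ 2 * σ := abs_le_of_sq_le_sq (by nlinarith [sq_nonneg b]) (by positivity)
  have hb2 : |b| ≤ 2 * σ := abs_le_of_sq_le_sq (by nlinarith [sq_nonneg a]) (by positivity)
  refine ⟨?_, hb2⟩
  have hAδ : 0 < A * δ := by positivity
  have hAσ : 0 ≤ A * σ ^ 2 := by positivity
  have hσA : σ ^ 2 ≤ A * σ ^ 2 := by nlinarith [sq_nonneg σ]
  by_cases hbig : 3 / 64 ≤ A * δ
  · linarith
  push Not at hbig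
  have e1 := abs_le.1 hw
  have e2 := abs_le.1 (mem_self m)
  have ht := mem_tan hσ hσ1 m
  set T := (x2 - y2) * n1 - (x1 - y1) * n2 with hT
  set V := (v1 - y1) * n1 + (v2 - y2) * n2 with hV
  have hTv : T = (v2 - y2) * n1 - (v1 - y1) * n2 := by
    rw [hT, m.hv1, m.hv2]; ring
  have hsum : V ^ 2 + T ^ 2 = (v1 - y1) ^ 2 + (v2 - y2) ^ 2 := by
    have : V ^ 2 + T ^ 2 = ((v1 - y1) ^ 2 + (v2 - y2) ^ 2) * (n1 ^ 2 + n2 ^ 2) := by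
      rw [hV, hTv]; ring
    rw [this, hn]; ring
  have hlow : 1 / 16 ≤ V ^ 2 + T ^ 2 := by
    have h7 : (1 / 2 : ℝ) ^ 2 ≤ ρ ^ 2 := pow_le_pow_left₀ (by norm_num) hρ 2
    rw [hsum]; linarith [e2.1]
  have hVu : V * a + T * b = (v1 - y1) * (w1 - v1) + (v2 - y2) * (w2 - v2) := by
    rw [hV, hTv, ha, hb]
    linear_combination ((v1 - y1) * (w1 - v1) + (v2 - y2) * (w2 - v2)) * hn
  have hu0 : 0 ≤ (w1 - v1) ^ 2 + (w2 - v2) ^ 2 := by positivity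
  have hVu2 : |V * a + T * b| ≤ 4 * (A * δ) + 2 * σ ^ 2 := by
    have hid : (w1 - y1) ^ 2 + (w2 - y2) ^ 2 - ρ ^ 2 - ((v1 - y1) ^ 2 + (v2 - y2) ^ 2 - ρ ^ 2)
        = (w1 - v1) ^ 2 + (w2 - v2) ^ 2 + 2 * (V * a + T * b) := by rw [hVu]; ring
    rw [abs_le]; constructor
    · linarith [e1.1, e2.2]
    · linarith [e1.2, e2.1]
  have hTb : |T * b| ≤ 16 * (A * δ) := by
    rw [abs_mul]
    have := mul_le_mul_of_nonneg_left hb2 (abs_nonneg T)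
    linarith
  have hTa : |T * a| ≤ 16 * (A * δ) := by
    rw [abs_mul]
    have := mul_le_mul_of_nonneg_left ha2 (abs_nonneg T)
    linarith
  have hVa : |V * a| ≤ 20 * (A * δ) + 2 * σ ^ 2 := by
    have : V * a = (V * a + T * b) - T * b := by ring
    rw [this]
    have := abs_sub (V * a + T * b) (T * b)
    linarith
  set Q := A * (σ ^ 2 + δ) with hQ
  have hQ0 : 0 < Q := by positivity
  have hVa' : |V * a| ≤ 20 * Q := by rw [hQ]; linarith
  have hTa' : |T * a| ≤ 16 * Q := by rw [hQ]; linarith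
  have s1 := sq_le_sq' (by linarith [abs_nonneg (V * a)]) hVa'
  have s2 := sq_le_sq' (by linarith [abs_nonneg (T * a)]) hTa'
  rw [sq_abs] at s1 s2
  apply abs_le_of_sq_le_sq _ (by positivity)
  have : 1 / 16 * a ^ 2 ≤ (V ^ 2 + T ^ 2) * a ^ 2 :=
    mul_le_mul_of_nonneg_right hlow (sq_nonneg a)
  linarith [sq_nonneg Q]

theorem mem_pair {A δ σ y1 y2 ρ x1 x2 r v1 v2 n1 n2 X1 X2 r' V1 V2 N1 N2 : ℝ}
    (hA : 100 ≤ A) (hδ : 0 < δ) (hδσ : δ ≤ σ) (hσ1 : σ ≤ 1)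
    (m : Mem A δ σ y1 y2 ρ x1 x2 r v1 v2 n1 n2)
    (M : Mem A δ σ y1 y2 ρ X1 X2 r' V1 V2 N1 N2)
    (hvV : (v1 - V1) ^ 2 + (v2 - V2) ^ 2 ≤ σ ^ 2) :
    |(V1 - x1) ^ 2 + (V2 - x2) ^ 2 - r ^ 2| ≤ 200000 * A ^ 2 * δ ∧
    |(x2 - X2) * N1 - (x1 - X1) * N2| ≤ 200000 * A ^ 2 * (δ / σ) ∧
    |(x1 - X1) * N1 + (x2 - X2) * N2| ≤ 200000 * A ^ 2 * (δ / (20 * A * (σ ^ 2 + δ))) := by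
  have hσ : 0 < σ := lt_of_lt_of_le hδ hδσ
  have hA0 : 0 < A := by linarith
  have hN : 0 < σ ^ 2 + δ := by positivity
  have hAδ : 0 < A * δ := by positivity
  have hAA : A * δ ≤ A ^ 2 * δ := by
    have : A * 1 ≤ A * A := mul_le_mul_of_nonneg_left (by linarith) hA0.le
    have := mul_le_mul_of_nonneg_right this hδ.le
    linarith
  have hn := m.hn
  have hNN := M.hn
  have hr := m.hr
  have htan := mem_tan hσ hσ1 m
  have hnor := mem_nor hA hδ hσ hσ1 m
  have hTan := mem_tan hσ hσ1 M
  have hNor := mem_nor hA hδ hσ hσ1 M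
  set t := (x2 - y2) * n1 - (x1 - y1) * n2 with ht
  set q := (x1 - y1) * n1 + (x2 - y2) * n2 with hq
  set T := (X2 - y2) * N1 - (X1 - y1) * N2 with hT
  set Q := (X1 - y1) * N1 + (X2 - y2) * N2 with hQ
  set k := n2 * N1 - n1 * N2 with hk
  set l := n1 * N1 + n2 * N2 with hl
  have hkl : k ^ 2 + l ^ 2 = 1 := by
    have : k ^ 2 + l ^ 2 = (n1 ^ 2 + n2 ^ 2) * (N1 ^ 2 + N2 ^ 2) := by rw [hk, hl]; ring
    rw [this, hn, hNN]; norm_num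
  have hk1 : |k| ≤ 1 := abs_le_of_sq_le_sq (by linarith [sq_nonneg l]) zero_le_one
  have hl1 : |l| ≤ 1 := abs_le_of_sq_le_sq (by linarith [sq_nonneg k]) zero_le_one
  -- angle
  have hkσ : |k| * σ ≤ 416 * (A * (σ ^ 2 + δ)) := by
    obtain ⟨c, hc, hc0, hc1, hc2, hp⟩ := mem_pts hσ hσ1 m
    have far : ∀ w1 w2 : ℝ, (w1 - v1) ^ 2 + (w2 - v2) ^ 2 ≤ σ ^ 2 →
        (w1 - V1) ^ 2 + (w2 - V2) ^ 2 ≤ 4 * σ ^ 2 := by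
      intro w1 w2 h
      have e : (w1 - V1) ^ 2 + (w2 - V2) ^ 2 + ((w1 - v1 - (v1 - V1)) ^ 2 +
        (w2 - v2 - (v2 - V2)) ^ 2) = 2 * ((w1 - v1) ^ 2 + (w2 - v2) ^ 2)
        + 2 * ((v1 - V1) ^ 2 + (v2 - V2) ^ 2) := by ring
      linarith [sq_nonneg (w1 - v1 - (v1 - V1)), sq_nonneg (w2 - v2 - (v2 - V2))]
    have a1 := (mem_near hA hδ hσ hσ1 M _ _ (m.hw _ _ (hp _ (Or.inl rfl)).1 (hp _ (Or.inl rfl)).2)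
      (far _ _ (hp _ (Or.inl rfl)).2)).1
    have a2 := (mem_near hA hδ hσ hσ1 M _ _ (m.hw _ _ (hp _ (Or.inr rfl)).1 (hp _ (Or.inr rfl)).2)
      (far _ _ (hp _ (Or.inr rfl)).2)).1
    rw [abs_le] at a1 a2
    have key : |r * σ * k| ≤ 208 * (A * (σ ^ 2 + δ)) := by
      rw [hk, abs_le]; constructor
      · linarith [a1.1, a2.2]
      · linarith [a1.2, a2.1]
    rw [abs_mul, abs_of_pos (by positivity)] at key
    have h1 : 0 ≤ |k| * σ := by positivity
    have h2 := mul_le_mul_of_nonneg_right hr h1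
    linarith
  -- decompositions
  have d1 : (x2 - y2) * N1 - (x1 - y1) * N2 = t * l + q * k := by
    rw [ht, hq, hk, hl]
    linear_combination (-((x2 - y2) * N1 - (x1 - y1) * N2)) * hn
  have d2 : (x1 - y1) * N1 + (x2 - y2) * N2 = q * l - t * k := by
    rw [ht, hq, hk, hl]
    linear_combination (-((x1 - y1) * N1 + (x2 - y2) * N2)) * hn
  have b1 : |t * l + q * k| * σ ≤ 27048 * (A ^ 2 * δ) := by
    have h1 : |t * l + q * k| ≤ |t| * |l| + |q| * |k| := by
      rw [← abs_mul, ← abs_mul]; exact abs_add_le _ _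
    have h2 : |t| * |l| ≤ |t| := mul_le_of_le_one_right (abs_nonneg _) hl1
    have h3 : (|q| * |k|) * σ ≤ 27040 * (A ^ 2 * δ) := by
      have e1 := mul_le_mul_of_nonneg_left hkσ (abs_nonneg q)
      have e2 := mul_le_mul_of_nonneg_left hnor (by positivity : 0 ≤ 416 * A)
      linarith
    have h4 := mul_le_mul_of_nonneg_right (h1.trans (add_le_add_left h2 _)) hσ.le
    linarith
  have b2 : |q * l - t * k| * (σ ^ 2 + δ) ≤ 81 * (A * δ) := by
    have h1 : |q * l - t * k| ≤ |q| * |l| + |t| * |k| := by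
      rw [← abs_mul, ← abs_mul]; exact abs_sub _ _
    have h2 : |q| * |l| ≤ |q| := mul_le_of_le_one_right (abs_nonneg _) hl1
    have h3 : |t| * |k| ≤ |t| := mul_le_of_le_one_right (abs_nonneg _) hk1
    have h4 : σ ^ 2 + δ ≤ 2 * σ := by
      have := mul_le_mul_of_nonneg_left hσ1 hσ.le
      linarith
    have h5 := mul_le_mul_of_nonneg_left h4 (abs_nonneg t)
    have h6 := mul_le_mul_of_nonneg_right (h1.trans (add_le_add h2 h3)) hN.le
    linarith
  refine ⟨?_, ?_, ?_⟩
  · -- value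
    have near := mem_near hA hδ hσ hσ1 M v1 v2 (mem_self m) (by linarith [sq_nonneg σ])
    have e1 := abs_le.1 (mem_self m)
    have e2 := abs_le.1 (mem_self M)
    set a := (v1 - V1) * N1 + (v2 - V2) * N2 with ha
    set b := (v2 - V2) * N1 - (v1 - V1) * N2 with hb
    have hid : (V1 - x1) ^ 2 + (V2 - x2) ^ 2 - r ^ 2
        = - ((v1 - y1) ^ 2 + (v2 - y2) ^ 2 - ρ ^ 2) + ((V1 - y1) ^ 2 + (V2 - y2) ^ 2 - ρ ^ 2)
          + 2 * ((t * l + q * k) * b + (q * l - t * k) * a) := by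
      have hv : (v1 - x1) ^ 2 + (v2 - x2) ^ 2 = r ^ 2 := by
        rw [m.hv1, m.hv2]; linear_combination r ^ 2 * hn
      rw [← d1, ← d2, ha, hb]
      linear_combination hv - 2 * ((x1 - y1) * (v1 - V1) + (x2 - y2) * (v2 - V2)) * hNN
    have p1 : |(t * l + q * k) * b| ≤ 2 * (27048 * (A ^ 2 * δ)) := by
      rw [abs_mul]
      have := mul_le_mul_of_nonneg_left near.2 (abs_nonneg (t * l + q * k))
      linarith
    have p2 : |(q * l - t * k) * a| ≤ 8424 * (A ^ 2 * δ) := by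
      rw [abs_mul]
      have e3 := mul_le_mul_of_nonneg_left near.1 (abs_nonneg (q * l - t * k))
      have e4 := mul_le_mul_of_nonneg_left b2 (by positivity : 0 ≤ 104 * A)
      linarith
    rw [hid]
    rw [abs_le] at p1 p2 ⊢
    constructor
    · linarith [e1.2, e2.1, p1.1, p2.1]
    · linarith [e1.1, e2.2, p1.2, p2.2]
  · have hid : (x2 - X2) * N1 - (x1 - X1) * N2 = (t * l + q * k) - T := by
      rw [← d1, hT]; ring
    rw [hid, ← mul_div_assoc, le_div_iff₀ hσ]
    have := mul_le_mul_of_nonneg_right (abs_sub (t * l + q * k) T) hσ.le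
    linarith
  · have hid : (x1 - X1) * N1 + (x2 - X2) * N2 = (q * l - t * k) - Q := by
      rw [← d2, hQ]; ring
    rw [hid, ← mul_div_assoc, le_div_iff₀ (by positivity)]
    have h1 := mul_le_mul_of_nonneg_right (abs_sub (q * l - t * k) Q) hN.le
    have h2 : |q * l - t * k - Q| * (σ ^ 2 + δ) ≤ 146 * (A * δ) := by linarith
    have h3 := mul_le_mul_of_nonneg_left h2 (by positivity : 0 ≤ 20 * A)
    have : 0 < A ^ 2 * δ := by positivity
    linarith

theorem mem_final {A δ σ y1 y2 ρ X1 X2 r' V1 V2 N1 N2 x1 x2 r z1 z2 s w1 w2 : ℝ}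
    (hA : 100 ≤ A) (hδ : 0 < δ) (hδσ : δ ≤ σ) (hσ1 : σ ≤ 1)
    (M : Mem A δ σ y1 y2 ρ X1 X2 r' V1 V2 N1 N2)
    (h1 : |((V1 - x1) ^ 2 + (V2 - x2) ^ 2 - r ^ 2) - ((V1 - z1) ^ 2 + (V2 - z2) ^ 2 - s ^ 2)| ≤ δ)
    (h2 : |((x2 - X2) * N1 - (x1 - X1) * N2) - ((z2 - X2) * N1 - (z1 - X1) * N2)| ≤ δ / σ)
    (h3 : |((x1 - X1) * N1 + (x2 - X2) * N2) - ((z1 - X1) * N1 + (z2 - X2) * N2)|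
      ≤ δ / (20 * A * (σ ^ 2 + δ)))
    (hw : |(w1 - y1) ^ 2 + (w2 - y2) ^ 2 - ρ ^ 2| ≤ 4 * (A * δ))
    (hwV : (w1 - V1) ^ 2 + (w2 - V2) ^ 2 ≤ 4 * σ ^ 2)
    (hz : |(w1 - z1) ^ 2 + (w2 - z2) ^ 2 - s ^ 2| ≤ 3 * δ) :
    |(w1 - x1) ^ 2 + (w2 - x2) ^ 2 - r ^ 2| ≤ 40 * δ := by
  have hσ : 0 < σ := lt_of_lt_of_le hδ hδσ
  have hA0 : 0 < A := by linarith
  have hN : 0 < σ ^ 2 + δ := by positivity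
  have near := mem_near hA hδ hσ hσ1 M w1 w2 hw hwV
  set a := (w1 - V1) * N1 + (w2 - V2) * N2 with ha
  set b := (w2 - V2) * N1 - (w1 - V1) * N2 with hb
  set α := ((V1 - x1) ^ 2 + (V2 - x2) ^ 2 - r ^ 2) - ((V1 - z1) ^ 2 + (V2 - z2) ^ 2 - s ^ 2)
    with hα
  set β := ((x2 - X2) * N1 - (x1 - X1) * N2) - ((z2 - X2) * N1 - (z1 - X1) * N2) with hβ
  set γ := ((x1 - X1) * N1 + (x2 - X2) * N2) - ((z1 - X1) * N1 + (z2 - X2) * N2) with hγ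
  have hid : (w1 - x1) ^ 2 + (w2 - x2) ^ 2 - r ^ 2 =
      ((w1 - z1) ^ 2 + (w2 - z2) ^ 2 - s ^ 2) + α - 2 * (β * b + γ * a) := by
    rw [hα, hβ, hγ, ha, hb]
    linear_combination (2 * ((x1 - z1) * (w1 - V1) + (x2 - z2) * (w2 - V2))) * M.hn
  have p1 : |β * b| ≤ 2 * δ := by
    rw [abs_mul]
    have := mul_le_mul h2 near.2 (abs_nonneg _) (by positivity)
    have e : δ / σ * (2 * σ) = 2 * δ := by field_simp
    linarith
  have p2 : |γ * a| ≤ 6 * δ := by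
    rw [abs_mul]
    have := mul_le_mul h3 near.1 (abs_nonneg _) (by positivity)
    have e : δ / (20 * A * (σ ^ 2 + δ)) * (104 * (A * (σ ^ 2 + δ))) = 104 / 20 * δ := by
      field_simp
    linarith
  rw [hid]
  rw [abs_le] at *
  constructor
  · linarith [h1.1, hz.1, p1.2, p2.2]
  · linarith [h1.2, hz.2, p1.1, p2.1]

theorem rect_val {p q : Param} (hp : p ∈ domD) (hq : q ∈ domD) {w : Plane} {δ ε : ℝ} (hδ1 : δ ≤ 1)
    (hε : 0 ≤ ε)
    (h : w ∈ annulus δ p) (h' : w ∈ annulus ε q) :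
    |(w 0 - q.1 0) ^ 2 + (w 1 - q.1 1) ^ 2 - q.2 ^ 2| ≤ 4 * ε := by
  obtain ⟨hp1, hp2, hp3⟩ := hp
  obtain ⟨hq1, hq2, hq3⟩ := hq
  have e1 := abs_le.1 (annulus_fwd (by linarith) h)
  have e2 := annulus_fwd (by linarith) h'
  have hd : dist p.1 q.1 ≤ 1 / 2 := by
    rw [dist_eq_norm]; have := norm_sub_le p.1 q.1; linarith
  have ht := dist_triangle w p.1 q.1
  rw [← dist_sq_plane]
  have : dist w q.1 ^ 2 - q.2 ^ 2 = (dist w q.1 - q.2) * (dist w q.1 + q.2) := by ring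
  have hn : 0 ≤ dist w q.1 := dist_nonneg
  rw [this, abs_mul, abs_of_nonneg (by linarith : 0 ≤ dist w q.1 + q.2), mul_comm 4]
  exact mul_le_mul e2 (by linarith [e1.2]) (by linarith) hε

theorem rect_val3 {p : Param} (hp : p ∈ domD) {w : Plane} {δ : ℝ} (hδ0 : 0 ≤ δ) (hδ1 : δ ≤ 1)
    (h : w ∈ annulus δ p) :
    |(w 0 - p.1 0) ^ 2 + (w 1 - p.1 1) ^ 2 - p.2 ^ 2| ≤ 3 * δ := by
  obtain ⟨hp1, hp2, hp3⟩ := hp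
  have e2 := annulus_fwd (by linarith) h
  have e1 := abs_le.1 e2
  rw [← dist_sq_plane]
  have : dist w p.1 ^ 2 - p.2 ^ 2 = (dist w p.1 - p.2) * (dist w p.1 + p.2) := by ring
  have hn : 0 ≤ dist w p.1 := dist_nonneg
  rw [this, abs_mul, abs_of_nonneg (by linarith : 0 ≤ dist w p.1 + p.2), mul_comm 3]
  exact mul_le_mul e2 (by linarith [e1.2]) (by linarith) hδ0

theorem val_annulus {p : Param} (hp : p ∈ domD) {w : Plane} {δ : ℝ}
    (h : |(w 0 - p.1 0) ^ 2 + (w 1 - p.1 1) ^ 2 - p.2 ^ 2| ≤ 40 * δ) :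
    w ∈ annulus (100 * δ) p := by
  obtain ⟨hp1, hp2, hp3⟩ := hp
  apply annulus_bwd (by linarith)
  rw [← dist_sq_plane] at h
  have : dist w p.1 ^ 2 - p.2 ^ 2 = (dist w p.1 - p.2) * (dist w p.1 + p.2) := by ring
  have hn : 0 ≤ dist w p.1 := dist_nonneg
  rw [this, abs_mul, abs_of_nonneg (by linarith : 0 ≤ dist w p.1 + p.2)] at h
  have h1 : |dist w p.1 - p.2| * (1 / 2) ≤ |dist w p.1 - p.2| * (dist w p.1 + p.2) :=
    mul_le_mul_of_nonneg_left (by linarith) (abs_nonneg _)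
  linarith [abs_nonneg (dist w p.1 - p.2)]

theorem mk_mem {A δ σ : ℝ} (hA : 100 ≤ A) (hδ : 0 < δ) (hδσ : δ ≤ σ) (hσ1 : σ ≤ 1)
    {r r₀ : Param × Plane} (hr : IsRectData r) (hr₀ : IsRectData r₀)
    (h : rect δ σ r.1 r.2 ⊆ rect (A * δ) (A * σ) r₀.1 r₀.2) :
    Mem A δ σ (r₀.1.1 0) (r₀.1.1 1) r₀.1.2 (r.1.1 0) (r.1.1 1) r.1.2 (r.2 0) (r.2 1)
      ((r.2 0 - r.1.1 0) / r.1.2) ((r.2 1 - r.1.1 1) / r.1.2) := by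
  have hσ : 0 < σ := lt_of_lt_of_le hδ hδσ
  have hAδ : 0 < A * δ := by have : 0 < A := by linarith
                             positivity
  obtain ⟨hp, hv⟩ := hr
  obtain ⟨hp1, hp2, hp3⟩ := id hp
  obtain ⟨hq, hv₀⟩ := hr₀
  obtain ⟨hq1, hq2, hq3⟩ := id hq
  have hpos : 0 < r.1.2 := by linarith
  have hv' : dist r.2 r.1.1 = r.1.2 := hv
  have hvs := dist_sq_plane r.2 r.1.1
  rw [hv'] at hvs
  constructor
  · field_simp; ring
  · field_simp; ring
  · rw [div_pow, div_pow, ← add_div, ← hvs]; field_simp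
  · exact hp2
  · exact hp3
  · exact hq2
  · rw [← dist_sq_plane]
    have hd : dist r.1.1 r₀.1.1 ≤ 1 / 2 := by
      rw [dist_eq_norm]; have := norm_sub_le r.1.1 r₀.1.1; linarith
    calc dist r.1.1 r₀.1.1 ^ 2 ≤ (1 / 2) ^ 2 := pow_le_pow_left₀ dist_nonneg hd 2
      _ = 1 / 4 := by norm_num
  · intro w1 w2 hw1 hw2
    have c1 : dist (!₂[w1, w2] : Plane) r.1.1 = r.1.2 := by
      rw [← sq_eq_sq₀ dist_nonneg hpos.le, dist_sq_plane]
      simpa using hw1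
    have c2 : dist (!₂[w1, w2] : Plane) r.2 ≤ σ := by
      rw [← sq_le_sq₀ dist_nonneg hσ.le, dist_sq_plane]
      simpa using hw2
    have hin : (!₂[w1, w2] : Plane) ∈ annulus δ r.1 := by
      apply annulus_bwd hpos.le
      rw [c1]; simpa using hδ.le
    have := rect_val hp hq (hδσ.trans hσ1) hAδ.le hin (h ⟨hin, c2⟩).1
    simpa using this

theorem coord_le (a b : Plane) : |a 0 - b 0| ≤ dist a b ∧ |a 1 - b 1| ≤ dist a b := by
  have := dist_sq_plane a b
  constructor
  · exact abs_le_of_sq_le_sq (by linarith [sq_nonneg (a 1 - b 1)]) dist_nonneg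
  · exact abs_le_of_sq_le_sq (by linarith [sq_nonneg (a 0 - b 0)]) dist_nonneg

/-- a family of pairwise `100`-incomparable `(δ,σ)`-rectangles all
contained in `A·𝐑` for a fixed `(δ,σ)`-rectangle `𝐑` has cardinality `≲ A^{10}`. -/
theorem incomparable_in_enlarged_rectangle :
    ∃ K > (0 : ℝ),
    ∀ A δ σ : ℝ, 100 ≤ A → 0 < δ → δ ≤ σ → σ ≤ 1 →
    ∀ R : Finset (Param × Plane), (∀ r ∈ R, IsRectData r) →
      (∀ r ∈ R, ∀ r' ∈ R, r ≠ r' → ¬ Comp δ σ 100 r r') →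
    ∀ r₀ : Param × Plane, IsRectData r₀ →
      (∀ r ∈ R, rect δ σ r.1 r.2 ⊆ rect (A * δ) (A * σ) r₀.1 r₀.2) →
      (R.card : ℝ) ≤ K * A ^ (10 : ℕ) := by
  classical
  refine ⟨64 * 800000 ^ 3, by norm_num, ?_⟩
  intro A δ σ hA hδ hδσ hσ1 R hR hinc r₀ hr₀ hsub
  have hσ : 0 < σ := lt_of_lt_of_le hδ hδσ
  have hA0 : 0 < A := by linarith
  have hN : 0 < σ ^ 2 + δ := by positivity
  have hL : 1 ≤ 200000 * A ^ 2 := by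
    have : (1 : ℝ) ≤ A ^ 2 := one_le_pow₀ (by linarith)
    linarith
  have mem := fun r (hr : r ∈ R) => mk_mem hA hδ hδσ hσ1 (hR r hr) hr₀ (hsub r hr)
  have hball : ∀ r ∈ R, dist r.2 r₀.2 ≤ A * σ := by
    intro r hr
    have h1 : r.2 ∈ rect δ σ r.1 r.2 := by
      refine ⟨?_, Metric.mem_closedBall_self hσ.le⟩
      have h2 : dist r.2 r.1.1 = r.1.2 := (hR r hr).2
      apply annulus_bwd (by rw [← h2]; exact dist_nonneg)
      rw [h2]; simpa using hδ.le
    exact (hsub r hr h1).2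
  have hfin : (R.card : ℝ) ≤ 4 * (2 * A) * (4 * (2 * A) * (4 * (200000 * A ^ 2) *
      (4 * (200000 * A ^ 2) * (4 * (200000 * A ^ 2) * 1)))) := by
    apply pack_aux R (fun r => r.2 0 - r₀.2 0) (σ / 2) _ _ (by positivity) (by linarith)
      (by positivity)
    · intro r hr
      have := (coord_le r.2 r₀.2).1
      have := hball r hr
      linarith
    intro R1 hR1 hc1
    apply pack_aux R1 (fun r => r.2 1 - r₀.2 1) (σ / 2) _ _ (by positivity) (by linarith)
      (by positivity)
    · intro r hr
      have := (coord_le r.2 r₀.2).2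
      have := hball r (hR1 hr)
      linarith
    intro R2 hR2 hc2
    rcases R2.eq_empty_or_nonempty with rfl | ⟨S, hS⟩
    · simp; positivity
    have hclose : ∀ r ∈ R2, ∀ s ∈ R2, (r.2 0 - s.2 0) ^ 2 + (r.2 1 - s.2 1) ^ 2 ≤ σ ^ 2 := by
      intro r hr s hs
      have e1 := hc1 r (hR2 hr) s (hR2 hs)
      have e2 := hc2 r hr s hs
      rw [sub_sub_sub_cancel_right] at e1 e2
      have f1 := pow_le_pow_left₀ (abs_nonneg _) e1 2
      have f2 := pow_le_pow_left₀ (abs_nonneg _) e2 2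
      rw [sq_abs] at f1 f2
      linarith [sq_nonneg σ]
    have inR : ∀ r ∈ R2, r ∈ R := fun r hr => hR1 (hR2 hr)
    have mS := mem S (inR S hS)
    have hpair := fun r (hr : r ∈ R2) =>
      mem_pair hA hδ hδσ hσ1 (mem r (inR r hr)) mS (hclose r hr S hS)
    apply pack_aux R2 (fun r => (S.2 0 - r.1.1 0) ^ 2 + (S.2 1 - r.1.1 1) ^ 2 - r.1.2 ^ 2)
      δ _ _ hδ hL (by positivity) (fun r hr => (hpair r hr).1)
    intro R3 hR3 hc3
    apply pack_aux R3 (fun r => (r.1.1 1 - S.1.1 1) * ((S.2 0 - S.1.1 0) / S.1.2) -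
        (r.1.1 0 - S.1.1 0) * ((S.2 1 - S.1.1 1) / S.1.2))
      (δ / σ) _ _ (by positivity) hL (by positivity) (fun r hr => (hpair r (hR3 hr)).2.1)
    intro R4 hR4 hc4
    apply pack_aux R4 (fun r => (r.1.1 0 - S.1.1 0) * ((S.2 0 - S.1.1 0) / S.1.2) +
        (r.1.1 1 - S.1.1 1) * ((S.2 1 - S.1.1 1) / S.1.2))
      (δ / (20 * A * (σ ^ 2 + δ))) _ _ (by positivity) hL (by positivity)
      (fun r hr => (hpair r (hR3 (hR4 hr))).2.2)
    intro R5 hR5 hc5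
    have : R5.card ≤ 1 := by
      rw [Finset.card_le_one]
      intro r hr s hs
      by_contra hne
      have hr4 := hR5 hr
      have hs4 := hR5 hs
      have hr3 := hR4 hr4
      have hs3 := hR4 hs4
      have hr2 := hR3 hr3
      have hs2 := hR3 hs3
      have hrR := inR r hr2
      have hsR := inR s hs2
      apply hinc r hrR s hsR hne
      have hσd : ∀ w : Plane, dist w s.2 ≤ σ → dist w r.2 ≤ 100 * σ := by
        intro w hw
        have h1 : dist s.2 r.2 ≤ σ := by
          rw [← sq_le_sq₀ dist_nonneg hσ.le, dist_sq_plane]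
          exact hclose s hs2 r hr2
        have := dist_triangle w s.2 r.2
        linarith
      refine ⟨r, hR r hrR, Set.union_subset ?_ ?_⟩
      · rintro w ⟨hw1, hw2⟩
        have hw1' : Metric.infDist w (circ r.1) ≤ δ := hw1
        have hw2' : dist w r.2 ≤ σ := hw2
        refine ⟨?_, ?_⟩
        · show Metric.infDist w (circ r.1) ≤ 100 * δ
          linarith
        · show dist w r.2 ≤ 100 * σ
          linarith
      · rintro w ⟨hw1, hw2⟩
        refine ⟨?_, hσd w hw2⟩
        apply val_annulus (hR r hrR).1
        have hA' : 0 ≤ A * δ := by positivity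
        refine mem_final hA hδ hδσ hσ1 mS (hc3 r hr3 s hs3) (hc4 r hr4 s hs4) (hc5 r hr s hs)
          (rect_val (hR s hsR).1 hr₀.1 (hδσ.trans hσ1) hA' hw1 (hsub s hsR ⟨hw1, hw2⟩).1) ?_
          (rect_val3 (hR s hsR).1 hδ.le (hδσ.trans hσ1) hw1)
        rw [← dist_sq_plane]
        have h1 : dist s.2 S.2 ≤ σ := by
          rw [← sq_le_sq₀ dist_nonneg hσ.le, dist_sq_plane]
          exact hclose s hs2 S hS
        have h2 := dist_triangle w s.2 S.2
        have h3 : dist w s.2 ≤ σ := hw2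
        have h4 : dist w S.2 ≤ 2 * σ := by linarith
        have := pow_le_pow_left₀ dist_nonneg h4 2
        linarith
    exact_mod_cast this
  have h8 : A ^ 8 ≤ A ^ 10 := pow_le_pow_right₀ (by linarith) (by norm_num)
  linarith

end
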